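/- arXiv:2209.04158 — 6 statements merged into one kernel-verified Lean document; each statement's English description precedes it below -/
import Mathlib

section
/- Let a > 0, b > 0, α ∈ (0,1), c = a²α²/(2b) and R_* = (a/(2b))·(1 - √(1 - α²)). Then the (improper Lebesgue) integral ∫₀^{R_*} 1 / √(c - 2as + 2bs²) ds equals (1/(2√(2b)))·log((1 + α)/(1 - α)). -/
/-- An antiderivative of `1 / √(p - 2as + 2bs²)` where the radicand and the logarithm's argument
are positive. -/
theorem hasDerivAt_log_add_sqrt_quadratic {a b p s : ℝ} (hb : 0 < b)
    (hs : 0 < a - 2 * b * s) (hP : 0 < p - 2 * a * s + 2 * b * s ^ 2) :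
    HasDerivAt (fun s : ℝ => -(1 / √(2 * b)) *
        Real.log (a - 2 * b * s + √(2 * b) * √(p - 2 * a * s + 2 * b * s ^ 2)))
      (1 / √(p - 2 * a * s + 2 * b * s ^ 2)) s := by
  have hw : 0 < √(2 * b) := Real.sqrt_pos.2 (by positivity)
  have hw2 : √(2 * b) ^ 2 = 2 * b := Real.sq_sqrt (by positivity)
  have hQ := Real.sqrt_pos.2 hP
  have h1 : HasDerivAt (fun s : ℝ => p - 2 * a * s + 2 * b * s ^ 2)
      (-(2 * (a - 2 * b * s))) s := by
    have := (((hasDerivAt_id' s).const_mul (2 * a)).const_sub p).add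
      (((hasDerivAt_id' s).pow 2).const_mul (2 * b))
    refine this.congr_deriv ?_
    norm_num
    ring
  have h2 : HasDerivAt (fun s : ℝ => a - 2 * b * s) (-(2 * b)) s := by
    simpa using ((hasDerivAt_id' s).const_mul (2 * b)).const_sub a
  have hne : 0 < a - 2 * b * s + √(2 * b) * √(p - 2 * a * s + 2 * b * s ^ 2) := by positivity
  have h := ((h2.add ((h1.sqrt hP.ne').const_mul √(2 * b))).log hne.ne').const_mul
    (-(1 / √(2 * b)))
  refine h.congr_deriv ?_
  simp only [Pi.add_apply]
  generalize √(p - 2 * a * s + 2 * b * s ^ 2) = Q at *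
  generalize √(2 * b) = w at *
  have hne' := hne.ne'
  rw [← hw2] at hne' ⊢
  field_simp
  ring

/-- For `a, b > 0`, `α ∈ (0,1)`, `c = a²α²/(2b)`, `R_* = (a/(2b))(1 - √(1-α²))`:
`∫₀^{R_*} 1 / √(c - 2as + 2bs²) ds = (1/(2√(2b))) log((1+α)/(1-α))`. -/
theorem stmt_4 (a b α : ℝ) (ha : 0 < a) (hb : 0 < b) (hα : α ∈ Set.Ioo (0 : ℝ) 1) :
    ∫ s in (0 : ℝ)..(a / (2 * b) * (1 - Real.sqrt (1 - α ^ 2))),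
        1 / Real.sqrt (a ^ 2 * α ^ 2 / (2 * b) - 2 * a * s + 2 * b * s ^ 2)
      = (1 / (2 * Real.sqrt (2 * b))) * Real.log ((1 + α) / (1 - α)) := by
  obtain ⟨hα0, hα1⟩ := hα
  have hk2pos : 0 < 1 - α ^ 2 := by nlinarith
  have hk : 0 < √(1 - α ^ 2) := Real.sqrt_pos.2 hk2pos
  have hk2 : √(1 - α ^ 2) ^ 2 = 1 - α ^ 2 := Real.sq_sqrt hk2pos.le
  have hlogk : Real.log √(1 - α ^ 2) = (Real.log (1 + α) + Real.log (1 - α)) / 2 := by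
    rw [Real.log_sqrt hk2pos.le, ← Real.log_mul (by linarith) (by linarith)]
    ring_nf
  set k := √(1 - α ^ 2)
  have hk1 : k < 1 := by nlinarith
  set R := a / (2 * b) * (1 - k) with hR
  have hR0 : 0 ≤ R := mul_nonneg (by positivity) (by linarith)
  have hRk : a - 2 * b * R = a * k := by rw [hR]; field_simp; ring
  have hP (s : ℝ) : a ^ 2 * α ^ 2 / (2 * b) - 2 * a * s + 2 * b * s ^ 2 =
      ((a - 2 * b * s) ^ 2 - (a * k) ^ 2) / (2 * b) := by
    rw [mul_pow, hk2]; field_simp; ring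
  have hlin {s : ℝ} (hs : s ≤ R) : a * k ≤ a - 2 * b * s := by rw [← hRk]; gcongr
  have hak : 0 < a * k := by positivity
  have hderiv : ∀ s ∈ Set.Ioo 0 R, HasDerivAt (fun s : ℝ => -(1 / √(2 * b)) *
      Real.log (a - 2 * b * s + √(2 * b) * √(a ^ 2 * α ^ 2 / (2 * b) - 2 * a * s + 2 * b * s ^ 2)))
      (1 / √(a ^ 2 * α ^ 2 / (2 * b) - 2 * a * s + 2 * b * s ^ 2)) s := by
    intro s hs
    have hlt : a * k < a - 2 * b * s := by rw [← hRk]; gcongr; exact hs.2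
    refine hasDerivAt_log_add_sqrt_quadratic hb (hak.trans hlt) ?_
    rw [hP]
    exact div_pos (by nlinarith) (by positivity)
  have hcont : ContinuousOn (fun s : ℝ => -(1 / √(2 * b)) * Real.log (a - 2 * b * s +
      √(2 * b) * √(a ^ 2 * α ^ 2 / (2 * b) - 2 * a * s + 2 * b * s ^ 2))) (Set.Icc 0 R) := by
    refine ContinuousOn.mul (by fun_prop) (ContinuousOn.log (by fun_prop) fun s hs => ?_)
    have := hak.trans_le (hlin hs.2)
    positivity
  have hint := (intervalIntegrable_iff_integrableOn_Ioc_of_le hR0).2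
    (intervalIntegral.integrableOn_deriv_of_nonneg hcont hderiv fun s _ => by positivity)
  rw [intervalIntegral.integral_eq_sub_of_hasDerivAt_of_le hR0 hcont hderiv hint]
  have h0 : √(2 * b) * √(a ^ 2 * α ^ 2 / (2 * b) - 2 * a * 0 + 2 * b * 0 ^ 2) = a * α := by
    rw [← Real.sqrt_mul (by positivity), ← Real.sqrt_sq (by positivity : 0 ≤ a * α)]
    congr 1
    field_simp
    ring
  simp only [h0]
  rw [hP, hRk, sub_self, zero_div, Real.sqrt_zero, mul_zero, add_zero,
    show a - 2 * b * 0 + a * α = a * (1 + α) by ring, Real.log_mul ha.ne' hk.ne',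
    Real.log_mul ha.ne' (by linarith), hlogk, Real.log_div (by linarith) (by linarith)]
  have hw : √(2 * b) ≠ 0 := (Real.sqrt_pos.2 (by positivity)).ne'
  field_simp
  ring
end

section
/- Let a > 0, b > 0, α ∈ (0,1), c = a²α²/(2b) and R_* = (a/(2b))·(1 - √(1 - α²)). Then the (improper Lebesgue) integral ∫₀^{R_*} s / √(c - 2as + 2bs²) ds equals (a/(2b)^{3/2})·( (1/2)·log((1 + α)/(1 - α)) - α ). -/
/-- An antiderivative of `s / √(c - 2as + 2bs²)` where the quadratic is positive and `s < a / (2b)`,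
written with `k = √(2b)`. -/
lemma hasDerivAt_sqrt_quadratic_sub_log {a b c k s : ℝ} (hk : 0 < k) (hkb : k ^ 2 = 2 * b)
    (hs : 0 < a - 2 * b * s) (hQ : 0 < c - 2 * a * s + 2 * b * s ^ 2) :
    HasDerivAt
      (fun s => Real.sqrt (c - 2 * a * s + 2 * b * s ^ 2) / k ^ 2
        - a / k ^ 3 * Real.log (a - 2 * b * s + k * Real.sqrt (c - 2 * a * s + 2 * b * s ^ 2)))
      (s / Real.sqrt (c - 2 * a * s + 2 * b * s ^ 2)) s := by
  have hq : HasDerivAt (fun s : ℝ => c - 2 * a * s + 2 * b * s ^ 2) (-(2 * (a - 2 * b * s))) s := by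
    have h := (((hasDerivAt_id' s).const_mul (2 * a)).const_sub c).add
      (((hasDerivAt_id' s).pow 2).const_mul (2 * b))
    convert! h using 1
    push_cast
    ring
  have hl : HasDerivAt (fun s : ℝ => a - 2 * b * s) (-(2 * b)) s := by
    simpa using! ((hasDerivAt_id' s).const_mul (2 * b)).const_sub a
  have hw := Real.sqrt_pos.2 hQ
  have hr := hq.sqrt hQ.ne'
  have hlog := (hl.add (hr.const_mul k)).log (add_pos hs (mul_pos hk (by simpa using hw))).ne'
  refine ((hr.div_const (k ^ 2)).sub (hlog.const_mul (a / k ^ 3))).congr_deriv ?_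
  simp only [Pi.add_apply]
  generalize Real.sqrt (c - 2 * a * s + 2 * b * s ^ 2) = w at *
  rw [← hkb] at hs ⊢
  have hden : a - k ^ 2 * s + k * w ≠ 0 := (add_pos hs (mul_pos hk hw)).ne'
  field_simp
  ring

theorem stmt_5 (a b α : ℝ) (ha : 0 < a) (hb : 0 < b) (hα : α ∈ Set.Ioo (0 : ℝ) 1) :
    ∫ s in (0 : ℝ)..(a / (2 * b) * (1 - Real.sqrt (1 - α ^ 2))),
        s / Real.sqrt (a ^ 2 * α ^ 2 / (2 * b) - 2 * a * s + 2 * b * s ^ 2)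
      = a / (2 * b) ^ ((3 : ℝ) / 2)
          * ((1 / 2) * Real.log ((1 + α) / (1 - α)) - α) := by
  obtain ⟨h0, h1⟩ := hα
  obtain ⟨k, hk, hkb⟩ : ∃ k : ℝ, 0 < k ∧ k ^ 2 = 2 * b :=
    ⟨Real.sqrt (2 * b), by positivity, Real.sq_sqrt (by positivity)⟩
  have hα2 : 0 < 1 - α ^ 2 := by nlinarith
  set r := Real.sqrt (1 - α ^ 2) with hr
  have hr0 : 0 < r := Real.sqrt_pos.2 hα2
  have hr2 : r ^ 2 = 1 - α ^ 2 := Real.sq_sqrt hα2.le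
  have hr1 : r < 1 := by nlinarith
  set R := a / (2 * b) * (1 - r) with hR
  have hRpos : 0 ≤ R := mul_nonneg (by positivity) (by linarith)
  have hRr : a - 2 * b * R = a * r := by rw [hR]; field_simp; ring
  have hQ (s : ℝ) : a ^ 2 * α ^ 2 / (2 * b) - 2 * a * s + 2 * b * s ^ 2
      = ((a - 2 * b * s) ^ 2 - (a * r) ^ 2) / (2 * b) := by
    rw [mul_pow, hr2]; field_simp; ring
  have hlin {s : ℝ} (hs : s ≤ R) : a * r ≤ a - 2 * b * s := by
    rw [← hRr]; gcongr
  have hlin' {s : ℝ} (hs : s < R) : a * r < a - 2 * b * s := by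
    rw [← hRr]; gcongr
  have har : 0 < a * r := mul_pos ha hr0
  have hcont : ContinuousOn (fun s => Real.sqrt (a ^ 2 * α ^ 2 / (2 * b) - 2 * a * s
        + 2 * b * s ^ 2) / k ^ 2
      - a / k ^ 3 * Real.log (a - 2 * b * s
        + k * Real.sqrt (a ^ 2 * α ^ 2 / (2 * b) - 2 * a * s + 2 * b * s ^ 2)))
      (Set.Icc 0 R) := by
    refine ContinuousOn.sub (by fun_prop) (ContinuousOn.mul (by fun_prop)
      (ContinuousOn.log (by fun_prop) fun s hs => ?_))
    have := har.trans_le (hlin hs.2)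
    positivity
  have hderiv (s : ℝ) (hs : s ∈ Set.Ioo 0 R) :=
    hasDerivAt_sqrt_quadratic_sub_log (c := a ^ 2 * α ^ 2 / (2 * b)) hk hkb
      (har.trans (hlin' hs.2)) (by
        rw [hQ]
        have := hlin' hs.2
        exact div_pos (by nlinarith) (by positivity))
  have hint := intervalIntegral.integrableOn_deriv_of_nonneg hcont hderiv
    fun s hs => div_nonneg hs.1.le (Real.sqrt_nonneg _)
  rw [intervalIntegral.integral_eq_sub_of_hasDerivAt_of_le hRpos hcont hderiv
    ((intervalIntegrable_iff_integrableOn_Ioc_of_le hRpos).2 hint)]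
  have hQR : a ^ 2 * α ^ 2 / (2 * b) - 2 * a * R + 2 * b * R ^ 2 = 0 := by
    rw [hQ, hRr, sub_self, zero_div]
  have hQ0 : Real.sqrt (a ^ 2 * α ^ 2 / (2 * b) - 2 * a * 0 + 2 * b * 0 ^ 2) = a * α / k := by
    rw [← hkb, ← Real.sqrt_sq (show 0 ≤ a * α / k by positivity)]
    congr 1
    ring
  have hpow : (2 * b) ^ ((3 : ℝ) / 2) = k ^ 3 := by
    rw [← hkb, ← Real.rpow_natCast k 2, ← Real.rpow_mul hk.le, ← Real.rpow_natCast k 3]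
    norm_num
  have hlogr : Real.log r = (Real.log (1 + α) + Real.log (1 - α)) / 2 := by
    rw [hr, Real.log_sqrt hα2.le, ← Real.log_mul (by linarith) (by linarith)]
    ring_nf
  have hlog0 : a - 2 * b * 0 + k * (a * α / k) = a * (1 + α) := by field_simp; ring
  rw [hQ0, hQR, hRr, hpow, Real.sqrt_zero, mul_zero, add_zero, hlog0,
    Real.log_mul ha.ne' hr0.ne', Real.log_mul ha.ne' (by linarith), hlogr,
    Real.log_div (by linarith) (by linarith)]
  field_simp
  ring
end

section
/- The function k₂(α) = ((1 - α²)/(2α))·log((1 + α)/(1 - α)) + α² is bounded above on (0,1), and τ_* := sup_{α ∈ (0,1)} k₂(α) satisfies τ_* > 1. -/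
/-- The function `k₂ α = ((1-α²)/(2α)) log((1+α)/(1-α)) + α²` is bounded above on
`(0,1)`, and `τ_* := sup_{α ∈ (0,1)} k₂(α)` satisfies `τ_* > 1`. -/
theorem stmt_12 :
    BddAbove
      ((fun α : ℝ => (1 - α ^ 2) / (2 * α) * Real.log ((1 + α) / (1 - α)) + α ^ 2) ''
        Set.Ioo 0 1) ∧
    1 < sSup
      ((fun α : ℝ => (1 - α ^ 2) / (2 * α) * Real.log ((1 + α) / (1 - α)) + α ^ 2) ''
        Set.Ioo 0 1) := by
  have h_bdd : BddAbove
      ((fun α : ℝ => (1 - α ^ 2) / (2 * α) * Real.log ((1 + α) / (1 - α)) + α ^ 2) ''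
        Set.Ioo 0 1) := by
    refine ⟨3, ?_⟩
    rintro _ ⟨α, ⟨h0, h1⟩, rfl⟩
    have h1' : 0 < 1 - α := sub_pos.mpr h1
    have hlog : Real.log ((1 + α) / (1 - α)) ≤ (1 + α) / (1 - α) - 1 :=
      Real.log_le_sub_one_of_pos (by positivity)
    have hcoef : 0 ≤ (1 - α ^ 2) / (2 * α) := div_nonneg (by nlinarith) (by positivity)
    have hprod : (1 - α ^ 2) / (2 * α) * ((1 + α) / (1 - α) - 1) = 1 + α := by
      field_simp
      ring
    have := mul_le_mul_of_nonneg_left hlog hcoef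
    rw [hprod] at this
    dsimp only
    nlinarith
  refine ⟨h_bdd, lt_csSup_of_lt h_bdd ⟨1 / 2, by norm_num, rfl⟩ ?_⟩
  have hlog : 1 < Real.log 3 :=
    (Real.lt_log_iff_exp_lt (by norm_num)).mpr (Real.exp_one_lt_d9.trans (by norm_num))
  norm_num
  linarith
end

section
/- The derivative k₂' of the function k₂(α) = ((1 - α²)/(2α))·log((1 + α)/(1 - α)) + α² has at most one zero in the interval (0,1). -/
theorem hasDerivAt_log_one_add_div_one_sub {t : ℝ} (h₁ : -1 < t) (h₂ : t < 1) :
    HasDerivAt (fun t : ℝ => Real.log ((1 + t) / (1 - t))) (2 / (1 - t ^ 2)) t := by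
  have ha : 1 + t ≠ 0 := by linarith
  have hb : 1 - t ≠ 0 := by linarith
  have hc : 1 - t ^ 2 ≠ 0 := by
    rw [show 1 - t ^ 2 = (1 + t) * (1 - t) by ring]
    exact mul_ne_zero ha hb
  refine ((((hasDerivAt_id' t).const_add 1).fun_div ((hasDerivAt_id' t).const_sub 1) hb).log
    (div_ne_zero ha hb)).congr_deriv ?_
  field_simp
  ring

/-- Critical points of `k₂` satisfy `log ((1+α)/(1-α)) = 2α(1+2α²)/(1+α²)`. -/
theorem log_eq_of_deriv_eq_zero {x : ℝ} (h₀ : 0 < x) (h₁ : x < 1)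
    (h : deriv (fun t : ℝ =>
      (1 - t ^ 2) / (2 * t) * Real.log ((1 + t) / (1 - t)) + t ^ 2) x = 0) :
    Real.log ((1 + x) / (1 - x)) - 2 * (x + 2 * x ^ 3) / (1 + x ^ 2) = 0 := by
  have hc : 1 - x ^ 2 ≠ 0 := by nlinarith
  have hx : x ≠ 0 := h₀.ne'
  have hd := (((((hasDerivAt_pow 2 x).const_sub 1).fun_div
    ((hasDerivAt_id' x).const_mul 2) (mul_ne_zero two_ne_zero hx)).fun_mul
    (hasDerivAt_log_one_add_div_one_sub (by linarith) h₁)).fun_add (hasDerivAt_pow 2 x))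
  rw [hd.deriv] at h
  have hp : 1 + x ^ 2 ≠ 0 := by positivity
  generalize Real.log ((1 + x) / (1 - x)) = L at h ⊢
  field_simp at h ⊢
  norm_num at h
  linear_combination -h

theorem hasDerivAt_log_sub {t : ℝ} (h₁ : -1 < t) (h₂ : t < 1) :
    HasDerivAt (fun t : ℝ =>
        Real.log ((1 + t) / (1 - t)) - 2 * (t + 2 * t ^ 3) / (1 + t ^ 2))
      (4 * t ^ 2 * (t ^ 4 + 2 * t ^ 2 - 1) / ((1 - t ^ 2) * (1 + t ^ 2) ^ 2)) t := by
  have hc : 1 - t ^ 2 ≠ 0 := by nlinarith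
  have hp : 1 + t ^ 2 ≠ 0 := by positivity
  refine ((hasDerivAt_log_one_add_div_one_sub h₁ h₂).fun_sub
    ((((hasDerivAt_id' t).fun_add ((hasDerivAt_pow 3 t).const_mul 2)).const_mul 2).fun_div
    ((hasDerivAt_pow 2 t).const_add 1) hp)).congr_deriv ?_
  field_simp
  norm_num
  ring

/-- Rolle's theorem for the function whose zeros are the critical points of `k₂`. -/
theorem exists_quartic_eq_zero {a b : ℝ} (h₀ : 0 ≤ a) (hab : a < b) (h₁ : b < 1)
    (ha : Real.log ((1 + a) / (1 - a)) - 2 * (a + 2 * a ^ 3) / (1 + a ^ 2) = 0)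
    (hb : Real.log ((1 + b) / (1 - b)) - 2 * (b + 2 * b ^ 3) / (1 + b ^ 2) = 0) :
    ∃ c ∈ Set.Ioo a b, c ^ 4 + 2 * c ^ 2 - 1 = 0 := by
  obtain ⟨c, hc, h⟩ := exists_hasDerivAt_eq_zero hab
    (fun t ht => (hasDerivAt_log_sub (by linarith [ht.1])
      (by linarith [ht.2])).continuousAt.continuousWithinAt) (ha.trans hb.symm)
    (fun t ht => hasDerivAt_log_sub (by linarith [ht.1]) (by linarith [ht.2]))
  have hc₀ : 0 < c := h₀.trans_lt hc.1
  have hc₁ : 1 - c ^ 2 ≠ 0 := by nlinarith [hc.2]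
  refine ⟨c, hc, ?_⟩
  have hd : (1 - c ^ 2) * (1 + c ^ 2) ^ 2 ≠ 0 := mul_ne_zero hc₁ (by positivity)
  exact (mul_eq_zero.mp ((div_eq_zero_iff.mp h).resolve_right hd)).resolve_left (by positivity)

theorem not_lt_of_deriv_eq_zero {x y : ℝ} (hx : 0 < x) (hy : y < 1)
    (hdx : deriv (fun t : ℝ =>
      (1 - t ^ 2) / (2 * t) * Real.log ((1 + t) / (1 - t)) + t ^ 2) x = 0)
    (hdy : deriv (fun t : ℝ =>
      (1 - t ^ 2) / (2 * t) * Real.log ((1 + t) / (1 - t)) + t ^ 2) y = 0) :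
    ¬ x < y := by
  intro hxy
  have hgx := log_eq_of_deriv_eq_zero hx (hxy.trans hy) hdx
  have hgy := log_eq_of_deriv_eq_zero (hx.trans hxy) hy hdy
  obtain ⟨c, hc, hqc⟩ := exists_quartic_eq_zero le_rfl hx (hxy.trans hy) (by simp) hgx
  obtain ⟨d, hd, hqd⟩ := exists_quartic_eq_zero hx.le hxy hy hgx hgy
  have hcd : c < d := hc.2.trans hd.1
  have hc₀ : 0 ≤ c := hc.1.le
  have h2 : c ^ 2 < d ^ 2 := by gcongr
  have h4 : c ^ 4 < d ^ 4 := by gcongr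
  linarith

/-- The derivative of `k₂ α = ((1-α²)/(2α)) log((1+α)/(1-α)) + α²` has at most one
zero in `(0,1)`. -/
theorem stmt_14 :
    ∀ x ∈ Set.Ioo (0 : ℝ) 1, ∀ y ∈ Set.Ioo (0 : ℝ) 1,
      deriv (fun t : ℝ => (1 - t ^ 2) / (2 * t) * Real.log ((1 + t) / (1 - t)) + t ^ 2) x = 0 →
      deriv (fun t : ℝ => (1 - t ^ 2) / (2 * t) * Real.log ((1 + t) / (1 - t)) + t ^ 2) y = 0 →
      x = y := by
  intro x hx y hy hdx hdy
  exact le_antisymm (not_lt.mp (not_lt_of_deriv_eq_zero hy.1 hx.2 hdy hdx))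
    (not_lt.mp (not_lt_of_deriv_eq_zero hx.1 hy.2 hdx hdy))
end

section
/- There exists a unique α_d ∈ (0,1) such that k₂(α_d) = sup_{α ∈ (0,1)} k₂(α); moreover k₂(α) < k₂(α_d) for every α ∈ (0,1) with α ≠ α_d. -/
open Set Real

/-- The derivative of `k₂` at `x` is `(1 + x ^ 2) / (2 * x ^ 2)` times this function. -/
noncomputable def kTwoSlope (x : ℝ) : ℝ :=
  4 * x - 2 * x / (1 + x ^ 2) - log ((1 + x) / (1 - x))

lemma hasDerivAt_log_one_add_div_one_sub_s15 {x : ℝ} (hx : x ∈ Ioo (-1 : ℝ) 1) :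
    HasDerivAt (fun x : ℝ => log ((1 + x) / (1 - x))) (2 / (1 - x ^ 2)) x := by
  have h1 : 1 + x ≠ 0 := by linarith [hx.1]
  have h2 : 1 - x ≠ 0 := by linarith [hx.2]
  have h3 : 1 - x ^ 2 ≠ 0 := by
    rw [show 1 - x ^ 2 = (1 + x) * (1 - x) by ring]
    exact mul_ne_zero h1 h2
  refine HasDerivAt.congr_deriv ((((hasDerivAt_id x).const_add 1).div ((hasDerivAt_id x).const_sub 1) h2).log
    (div_ne_zero h1 h2)) ?_
  simp only [id, Pi.div_apply]
  field_simp
  ring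

lemma hasDerivAt_kTwoSlope {x : ℝ} (hx : x ∈ Ioo (-1 : ℝ) 1) :
    HasDerivAt kTwoSlope
      (4 * x ^ 2 * (1 - 2 * x ^ 2 - x ^ 4) / ((1 + x ^ 2) ^ 2 * (1 - x ^ 2))) x := by
  have h1 : 1 + x ^ 2 ≠ 0 := by positivity
  have h3 : 1 - x ^ 2 ≠ 0 := by nlinarith [hx.1, hx.2]
  refine HasDerivAt.congr_deriv ((((hasDerivAt_id x).const_mul 4).sub
    (((hasDerivAt_id x).const_mul 2).div ((hasDerivAt_pow 2 x).const_add 1) h1)).sub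
    (hasDerivAt_log_one_add_div_one_sub_s15 hx)) ?_
  simp only [id, Nat.cast_ofNat]
  field_simp
  ring

lemma hasDerivAt_kTwo {x : ℝ} (hx : x ∈ Ioo (0 : ℝ) 1) :
    HasDerivAt (fun x : ℝ => (1 - x ^ 2) / (2 * x) * log ((1 + x) / (1 - x)) + x ^ 2)
      ((1 + x ^ 2) / (2 * x ^ 2) * kTwoSlope x) x := by
  have h0 : x ≠ 0 := hx.1.ne'
  have h1 : 1 + x ^ 2 ≠ 0 := by positivity
  have h3 : 1 - x ^ 2 ≠ 0 := by nlinarith [hx.1, hx.2]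
  refine HasDerivAt.congr_deriv (((((hasDerivAt_pow 2 x).const_sub 1).div ((hasDerivAt_id x).const_mul 2)
    (mul_ne_zero two_ne_zero h0)).mul
    (hasDerivAt_log_one_add_div_one_sub_s15 ⟨by linarith [hx.1], hx.2⟩)).add
    (hasDerivAt_pow 2 x)) ?_
  simp only [id, kTwoSlope, Pi.div_apply, Nat.cast_ofNat]
  generalize log ((1 + x) / (1 - x)) = l
  field_simp
  ring

lemma continuousOn_kTwoSlope : ContinuousOn kTwoSlope (Ioo (-1) 1) :=
  fun _ hx => (hasDerivAt_kTwoSlope hx).continuousAt.continuousWithinAt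

lemma strictMonoOn_kTwoSlope : StrictMonoOn kTwoSlope (Icc 0 √(√2 - 1)) := by
  have h2 : √2 ^ 2 = 2 := sq_sqrt zero_le_two
  have hlt : √2 < 3 / 2 := by rw [sqrt_lt' (by norm_num)]; norm_num
  have hb : √(√2 - 1) < 1 := by rw [sqrt_lt' one_pos]; linarith
  refine strictMonoOn_of_deriv_pos (convex_Icc _ _)
    (continuousOn_kTwoSlope.mono fun x hx => ⟨by linarith [hx.1], hx.2.trans_lt hb⟩) ?_
  intro x hx
  rw [interior_Icc] at hx
  have hx0 := hx.1
  have hx1 := hx.2.trans hb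
  have hxs : x ^ 2 < √2 - 1 := (lt_sqrt hx0.le).1 hx.2
  rw [(hasDerivAt_kTwoSlope ⟨by linarith, hx1⟩).deriv]
  have h3 : 0 < 1 - x ^ 2 := by linarith
  have h4 : 0 < 1 - 2 * x ^ 2 - x ^ 4 := by nlinarith [sq_nonneg x]
  positivity

lemma strictAntiOn_kTwoSlope : StrictAntiOn kTwoSlope (Ico √(√2 - 1) 1) := by
  have h2 : √2 ^ 2 = 2 := sq_sqrt zero_le_two
  have hgt : 1 < √2 := by rw [lt_sqrt zero_le_one]; norm_num
  have hb : 0 < √(√2 - 1) := sqrt_pos.2 (by linarith)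
  refine strictAntiOn_of_deriv_neg (convex_Ico _ _)
    (continuousOn_kTwoSlope.mono fun x hx => ⟨by linarith [hx.1], hx.2⟩) ?_
  intro x hx
  rw [interior_Ico] at hx
  have hx0 := hb.trans hx.1
  have hxs : √2 - 1 < x ^ 2 := (sqrt_lt' hx0).1 hx.1
  rw [(hasDerivAt_kTwoSlope ⟨by linarith, hx.2⟩).deriv]
  have h3 : 0 < 1 - x ^ 2 := by nlinarith [hx.2]
  have h4 : 1 - 2 * x ^ 2 - x ^ 4 < 0 := by nlinarith [sq_nonneg x]
  exact div_neg_of_neg_of_pos (mul_neg_of_pos_of_neg (by positivity) h4) (by positivity)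

lemma kTwoSlope_neg : kTwoSlope (19 / 20) < 0 := by
  have h : (3 : ℝ) < log 39 := by
    rw [lt_log_iff_exp_lt (by norm_num), show (3 : ℝ) = (3 : ℕ) * 1 by norm_num, exp_nat_mul]
    calc exp 1 ^ 3 < 3 ^ 3 := by gcongr; linarith [exp_one_lt_d9]
      _ < 39 := by norm_num
  norm_num [kTwoSlope]
  linarith

/-- `kTwoSlope` changes sign exactly once on `(0,1)`, from positive to negative. -/
lemma exists_kTwoSlope_sign_change :
    ∃ c ∈ Ioo (0 : ℝ) 1, (∀ x ∈ Ioo 0 c, 0 < kTwoSlope x) ∧ ∀ x ∈ Ioo c 1, kTwoSlope x < 0 := by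
  have hgt : 1 < √2 := by rw [lt_sqrt zero_le_one]; norm_num
  have hlt : √2 < 3 / 2 := by rw [sqrt_lt' (by norm_num)]; norm_num
  have hb0 : 0 < √(√2 - 1) := sqrt_pos.2 (by linarith)
  have hb1 : √(√2 - 1) < 19 / 20 := by rw [sqrt_lt' (by norm_num)]; linarith
  have hmono := strictMonoOn_kTwoSlope
  have hanti := strictAntiOn_kTwoSlope
  set b := √(√2 - 1)
  have hzero : kTwoSlope 0 = 0 := by simp [kTwoSlope]
  have hpos : ∀ x ∈ Ioc 0 b, 0 < kTwoSlope x := fun x hx =>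
    hzero ▸ hmono (left_mem_Icc.2 hb0.le) (Ioc_subset_Icc_self hx) hx.1
  obtain ⟨c, hc, hgc⟩ := intermediate_value_Icc' hb1.le
    (continuousOn_kTwoSlope.mono fun x hx => ⟨by linarith [hx.1], by linarith [hx.2]⟩)
    ⟨kTwoSlope_neg.le, (hpos b (right_mem_Ioc.2 hb0)).le⟩
  have hc' : c ∈ Ico b 1 := ⟨hc.1, by linarith [hc.2]⟩
  refine ⟨c, ⟨hb0.trans_le hc.1, hc'.2⟩, fun x hx => ?_, fun x hx => ?_⟩
  · rcases le_total x b with h | h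
    · exact hpos x ⟨hx.1, h⟩
    · exact hgc ▸ hanti ⟨h, hx.2.trans hc'.2⟩ hc' hx.2
  · exact hgc ▸ hanti hc' ⟨hc.1.trans hx.1.le, hx.2⟩ hx.1

lemma exists_kTwo_lt :
    ∃ c ∈ Ioo (0 : ℝ) 1, ∀ x ∈ Ioo (0 : ℝ) 1, x ≠ c →
      (1 - x ^ 2) / (2 * x) * log ((1 + x) / (1 - x)) + x ^ 2
        < (1 - c ^ 2) / (2 * c) * log ((1 + c) / (1 - c)) + c ^ 2 := by
  obtain ⟨c, hc, hpos, hneg⟩ := exists_kTwoSlope_sign_change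
  refine ⟨c, hc, fun x hx hxc => ?_⟩
  have hcont : ContinuousOn
      (fun x : ℝ => (1 - x ^ 2) / (2 * x) * log ((1 + x) / (1 - x)) + x ^ 2) (Ioo 0 1) :=
    fun y hy => (hasDerivAt_kTwo hy).continuousAt.continuousWithinAt
  rcases hxc.lt_or_gt with h | h
  · refine strictMonoOn_of_deriv_pos (convex_Ioc 0 c)
      (hcont.mono fun y hy => ⟨hy.1, hy.2.trans_lt hc.2⟩) (fun y hy => ?_)
      ⟨hx.1, h.le⟩ (right_mem_Ioc.2 hc.1) h
    rw [interior_Ioc] at hy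
    rw [(hasDerivAt_kTwo ⟨hy.1, hy.2.trans hc.2⟩).deriv]
    have := hy.1
    exact mul_pos (by positivity) (hpos y hy)
  · refine strictAntiOn_of_deriv_neg (convex_Ico c 1)
      (hcont.mono fun y hy => ⟨hc.1.trans_le hy.1, hy.2⟩) (fun y hy => ?_)
      (left_mem_Ico.2 hc.2) ⟨h.le, hx.2⟩ h
    rw [interior_Ico] at hy
    have := hc.1.trans hy.1
    rw [(hasDerivAt_kTwo ⟨this, hy.2⟩).deriv]
    exact mul_neg_of_pos_of_neg (by positivity) (hneg y hy)


/-- There is a unique `α_d ∈ (0,1)` at which `k₂` attains its supremum over `(0,1)`;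
moreover `k₂(α) < k₂(α_d)` for every other `α ∈ (0,1)`. -/
theorem stmt_15 :
    ∃! αd : ℝ, αd ∈ Set.Ioo (0 : ℝ) 1 ∧
      IsGreatest
        ((fun α : ℝ => (1 - α ^ 2) / (2 * α) * Real.log ((1 + α) / (1 - α)) + α ^ 2) ''
          Set.Ioo 0 1)
        ((1 - αd ^ 2) / (2 * αd) * Real.log ((1 + αd) / (1 - αd)) + αd ^ 2) ∧
      ∀ α ∈ Set.Ioo (0 : ℝ) 1, α ≠ αd →
        (1 - α ^ 2) / (2 * α) * Real.log ((1 + α) / (1 - α)) + α ^ 2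
          < (1 - αd ^ 2) / (2 * αd) * Real.log ((1 + αd) / (1 - αd)) + αd ^ 2 := by
  obtain ⟨c, hc, hlt⟩ := exists_kTwo_lt
  refine ⟨c, ⟨hc, ⟨mem_image_of_mem _ hc, ?_⟩, hlt⟩, fun y hy => ?_⟩
  · rintro _ ⟨x, hx, rfl⟩
    rcases eq_or_ne x c with rfl | h
    · exact le_rfl
    · exact (hlt x hx h).le
  · by_contra h
    exact lt_asymm (hlt y hy.1 h) (hy.2.2 c hc (Ne.symm h))
end

section
/- Let p, q : ℝ → ℝ be continuous with p(x) < q(x) for every x ∈ ℝ. Let u, v : ℝ → ℝ be twice continuously differentiable with u''(x) + p(x)·u(x) = 0 and v''(x) + q(x)·v(x) = 0 for all x, such that u, u', u'', v, v', v'' all tend to 0 as x → ±∞ and u is not identically zero. Then v has at least one zero in ℝ. -/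
open Filter Topology Set in
/-- One-sided Sturm comparison: where `u` is positive, the Wronskian `u' v - u v'` with a positive
solution `v` of the equation with the larger coefficient is negative, provided that it
tends to `0` at `+∞`. -/
theorem wronskian_neg_of_pos {p q u u' v v' : ℝ → ℝ} (hpq : ∀ x, p x < q x)
    (hu : ∀ x, HasDerivAt u (u' x) x) (hu' : ∀ x, HasDerivAt u' (-(p x * u x)) x)
    (hv : ∀ x, HasDerivAt v (v' x) x) (hv' : ∀ x, HasDerivAt v' (-(q x * v x)) x)
    (hW : Tendsto (fun x => u' x * v x - u x * v' x) atTop (𝓝 0))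
    (hpos : ∀ x, 0 < v x) {a : ℝ} (ha : 0 < u a) :
    u' a * v a - u a * v' a < 0 := by
  set W : ℝ → ℝ := fun x => u' x * v x - u x * v' x with hWdef
  have hWd : ∀ x, HasDerivAt W ((q x - p x) * u x * v x) x := fun x =>
    (((hu' x).mul (hv x)).sub ((hu x).mul (hv' x))).congr_deriv (by ring)
  have hWc : Continuous W := continuous_iff_continuousAt.2 fun x => (hWd x).continuousAt
  have huc : Continuous u := continuous_iff_continuousAt.2 fun x => (hu x).continuousAt
  by_contra! hWa
  have hWa : 0 ≤ W a := hWa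
  have hWmono : ∀ b, (∀ x ∈ Ico a b, 0 < u x) → StrictMonoOn W (Icc a b) := fun b hb => by
    refine strictMonoOn_of_deriv_pos (convex_Icc a b) hWc.continuousOn fun x hx => ?_
    rw [interior_Icc] at hx
    rw [(hWd x).deriv]
    exact mul_pos (mul_pos (sub_pos.2 (hpq x)) (hb x ⟨hx.1.le, hx.2⟩)) (hpos x)
  have hupos : ∀ x, a ≤ x → 0 < u x := by
    by_contra! h
    obtain ⟨y, hay, hy⟩ := h
    set S : Set ℝ := Ici a ∩ {x | u x ≤ 0}
    have hSbdd : BddBelow S := ⟨a, fun x hx => hx.1⟩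
    have hSclosed : IsClosed S := isClosed_Ici.inter (isClosed_le huc continuous_const)
    obtain ⟨hab, hub⟩ := hSclosed.csInf_mem ⟨y, hay, hy⟩ hSbdd
    set b := sInf S
    have hb : ∀ x ∈ Ico a b, 0 < u x := fun x hx => by
      by_contra! hx0
      exact (csInf_le hSbdd ⟨hx.1, hx0⟩).not_gt hx.2
    have hdiv : ∀ x, HasDerivAt (fun x => u x / v x) (W x / v x ^ 2) x := fun x =>
      (hu x).div (hv x) (hpos x).ne'
    have hmono : MonotoneOn (fun x => u x / v x) (Icc a b) := by
      refine monotoneOn_of_deriv_nonneg (convex_Icc a b)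
        (fun x _ => (hdiv x).continuousAt.continuousWithinAt)
        (fun x _ => (hdiv x).differentiableAt.differentiableWithinAt) fun x hx => ?_
      rw [(hdiv x).deriv]
      have hx := interior_subset hx
      exact div_nonneg (hWa.trans ((hWmono b hb).monotoneOn (left_mem_Icc.2 hab) hx hx.1))
        (sq_nonneg _)
    have h := hmono (left_mem_Icc.2 hab) (right_mem_Icc.2 hab) hab
    exact ((div_pos ha (hpos a)).trans_le h).not_ge (div_nonpos_of_nonpos_of_nonneg hub (hpos b).le)
  have hlt : ∀ x y, a ≤ x → x < y → W x < W y := fun x y hx hxy =>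
    hWmono y (fun z hz => hupos z hz.1) ⟨hx, hxy.le⟩ ⟨hx.trans hxy.le, le_rfl⟩ hxy
  have h1 : W (a + 1) ≤ 0 := ge_of_tendsto hW <| by
    filter_upwards [eventually_gt_atTop (a + 1)] with x hx
    exact (hlt _ _ (by linarith) hx).le
  linarith [hlt a (a + 1) le_rfl (by linarith)]

open Filter Topology in
/-- A solution `u` which is positive somewhere cannot coexist with a positive solution `v` of the
equation with the larger coefficient when their Wronskian vanishes at `±∞`. -/
theorem not_pos_of_wronskian_tendsto_zero {p q u u' v v' : ℝ → ℝ} (hpq : ∀ x, p x < q x)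
    (hu : ∀ x, HasDerivAt u (u' x) x) (hu' : ∀ x, HasDerivAt u' (-(p x * u x)) x)
    (hv : ∀ x, HasDerivAt v (v' x) x) (hv' : ∀ x, HasDerivAt v' (-(q x * v x)) x)
    (hWtop : Tendsto (fun x => u' x * v x - u x * v' x) atTop (𝓝 0))
    (hWbot : Tendsto (fun x => u' x * v x - u x * v' x) atBot (𝓝 0))
    (hpos : ∀ x, 0 < v x) (a : ℝ) : u a ≤ 0 := by
  by_contra! ha
  have hright := wronskian_neg_of_pos hpq hu hu' hv hv' hWtop hpos ha
  have hreflect : ∀ {f f' : ℝ → ℝ}, (∀ x, HasDerivAt f (f' x) x) →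
      ∀ x, HasDerivAt (fun y => f (-y)) (-f' (-x)) x := fun hf x =>
    ((hf (-x)).comp x (hasDerivAt_neg x)).congr_deriv (by ring)
  have hleft := wronskian_neg_of_pos (p := fun x => p (-x)) (q := fun x => q (-x))
    (u := fun x => u (-x)) (u' := fun x => -u' (-x)) (v := fun x => v (-x))
    (v' := fun x => -v' (-x)) (a := -a) (fun x => hpq (-x)) (hreflect hu)
    (fun x => (hreflect hu' x).neg.congr_deriv (by ring)) (hreflect hv)
    (fun x => (hreflect hv' x).neg.congr_deriv (by ring))
    (by
      convert (hWbot.comp tendsto_neg_atTop_atBot).neg using 2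
      · simp only [Function.comp_apply]
        ring
      · simp)
    (fun x => hpos (-x)) (by simpa using ha)
  simp only [neg_neg] at hleft
  linarith


/-- Sturm comparison with decay at infinity: if `p < q` are continuous, `u, v` are
`C²` solutions of `u'' + p u = 0` and `v'' + q v = 0` such that `u, u', u''` and
`v, v', v''` all tend to `0` at `±∞`, and `u` is not identically zero, then `v`
has at least one zero on `ℝ`. -/
theorem stmt_18 (p q : ℝ → ℝ) (hp : Continuous p) (hq : Continuous q)
    (hpq : ∀ x : ℝ, p x < q x)
    (u u' u'' v v' v'' : ℝ → ℝ)
    (hu : ∀ x : ℝ, HasDerivAt u (u' x) x) (hu' : ∀ x : ℝ, HasDerivAt u' (u'' x) x)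
    (hu'' : Continuous u'')
    (hv : ∀ x : ℝ, HasDerivAt v (v' x) x) (hv' : ∀ x : ℝ, HasDerivAt v' (v'' x) x)
    (hv'' : Continuous v'')
    (hue : ∀ x : ℝ, u'' x + p x * u x = 0)
    (hve : ∀ x : ℝ, v'' x + q x * v x = 0)
    (hu0 : Filter.Tendsto u Filter.atTop (nhds 0))
    (hu0' : Filter.Tendsto u' Filter.atTop (nhds 0))
    (hu0'' : Filter.Tendsto u'' Filter.atTop (nhds 0))
    (hu1 : Filter.Tendsto u Filter.atBot (nhds 0))
    (hu1' : Filter.Tendsto u' Filter.atBot (nhds 0))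
    (hu1'' : Filter.Tendsto u'' Filter.atBot (nhds 0))
    (hv0 : Filter.Tendsto v Filter.atTop (nhds 0))
    (hv0' : Filter.Tendsto v' Filter.atTop (nhds 0))
    (hv0'' : Filter.Tendsto v'' Filter.atTop (nhds 0))
    (hv1 : Filter.Tendsto v Filter.atBot (nhds 0))
    (hv1' : Filter.Tendsto v' Filter.atBot (nhds 0))
    (hv1'' : Filter.Tendsto v'' Filter.atBot (nhds 0))
    (hune : ∃ x : ℝ, u x ≠ 0) :
    ∃ x : ℝ, v x = 0 := by
  have hud : ∀ x, HasDerivAt u' (-(p x * u x)) x := fun x => by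
    rw [← eq_neg_of_add_eq_zero_left (hue x)]
    exact hu' x
  have hvd : ∀ x, HasDerivAt v' (-(q x * v x)) x := fun x => by
    rw [← eq_neg_of_add_eq_zero_left (hve x)]
    exact hv' x
  have hWtop : Filter.Tendsto (fun x => u' x * v x - u x * v' x) Filter.atTop (nhds 0) := by
    simpa using (hu0'.mul hv0).sub (hu0.mul hv0')
  have hWbot : Filter.Tendsto (fun x => u' x * v x - u x * v' x) Filter.atBot (nhds 0) := by
    simpa using (hu1'.mul hv1).sub (hu1.mul hv1')
  have key : ∀ s t : ℝ, (∀ x, 0 < t * v x) → ∀ x, s * u x ≤ 0 := fun s t ht x =>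
    not_pos_of_wronskian_tendsto_zero (u := fun x => s * u x) (u' := fun x => s * u' x)
      (v := fun x => t * v x) (v' := fun x => t * v' x) hpq
      (fun x => (hu x).const_mul s)
      (fun x => ((hud x).const_mul s).congr_deriv (by ring))
      (fun x => (hv x).const_mul t)
      (fun x => ((hvd x).const_mul t).congr_deriv (by ring))
      (by convert hWtop.const_mul (s * t) using 2 <;> ring)
      (by convert hWbot.const_mul (s * t) using 2 <;> ring) ht x
  have hvc : Continuous v := continuous_iff_continuousAt.2 fun x => (hv x).continuousAt
  by_contra! hne
  have hsign : ∃ t : ℝ, ∀ x, 0 < t * v x := by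
    refine ⟨v 0, fun x => ?_⟩
    by_contra! h
    have hmem : (0 : ℝ) ∈ Set.range fun y => v 0 * v y :=
      mem_range_of_exists_le_of_exists_ge (continuous_const.mul hvc) ⟨x, h⟩
        ⟨0, mul_self_nonneg (v 0)⟩
    obtain ⟨y, hy⟩ := hmem
    exact mul_ne_zero (hne 0) (hne y) hy
  obtain ⟨t, ht⟩ := hsign
  obtain ⟨x, hx⟩ := hune
  exact (mul_self_pos.2 hx).not_ge (key (u x) t ht x)
end
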